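/- For an immersed submanifold of R^n, Simons' identity holds: Δ A^α_{lk} = ∇_l∇_k H^α + R^m_l A^α_{mk} + R^m_k A^α_{ml} − 2 A^α_{jm} R_l{}^j{}_k{}^m + F^α_m(∇_l R^m_k + ∇_k R^m_l − ∇^m R_{lk}). -/

import Mathlib

noncomputable section

open Real Finset

/-- Partial derivative of a scalar function on `ℝ^m` in direction `i`. -/
def pd {m : ℕ} (f : (Fin m → ℝ) → ℝ) (i : Fin m) (x : Fin m → ℝ) : ℝ :=
  fderiv ℝ f x (Pi.single i 1)

/-- Components `F^α_i` of the differential of an immersion `F : ℝ^m → ℝ^n`. -/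
def Fd {m n : ℕ} (F : (Fin m → ℝ) → (Fin n → ℝ)) (α : Fin n) (i : Fin m)
    (x : Fin m → ℝ) : ℝ :=
  pd (fun y => F y α) i x

/-- Induced metric `g_{ij} = ⟨F_i, F_j⟩`. -/
def gInd {m n : ℕ} (F : (Fin m → ℝ) → (Fin n → ℝ)) (i j : Fin m) (x : Fin m → ℝ) : ℝ :=
  ∑ α, Fd F α i x * Fd F α j x

/-- Induced metric as a matrix. -/
def gMat {m n : ℕ} (F : (Fin m → ℝ) → (Fin n → ℝ)) (x : Fin m → ℝ) :
    Matrix (Fin m) (Fin m) ℝ :=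
  fun i j => gInd F i j x

/-- Inverse metric `g^{ij}`. -/
def gInv {m n : ℕ} (F : (Fin m → ℝ) → (Fin n → ℝ)) (i j : Fin m) (x : Fin m → ℝ) : ℝ :=
  (gMat F x)⁻¹ i j

/-- Christoffel symbols `Γ^k_{ij}` of the induced metric. -/
def chr {m n : ℕ} (F : (Fin m → ℝ) → (Fin n → ℝ)) (k i j : Fin m) (x : Fin m → ℝ) : ℝ :=
  (1/2) * ∑ l, gInv F k l x *
    (pd (gInd F l j) i x + pd (gInd F l i) j x - pd (gInd F i j) l x)

/-- Second fundamental form `A^α_{ij} = F^α_{ij} - Γ^k_{ij} F^α_k`. -/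
def sff {m n : ℕ} (F : (Fin m → ℝ) → (Fin n → ℝ)) (α : Fin n) (i j : Fin m)
    (x : Fin m → ℝ) : ℝ :=
  pd (fun y => Fd F α j y) i x - ∑ k, chr F k i j x * Fd F α k x

/-- Mean curvature vector `H^α = g^{ij} A^α_{ij}`. -/
def mcv {m n : ℕ} (F : (Fin m → ℝ) → (Fin n → ℝ)) (α : Fin n) (x : Fin m → ℝ) : ℝ :=
  ∑ i, ∑ j, gInv F i j x * sff F α i j x

/-- Riemann curvature tensor `R^l_{kij}` of the induced metric. -/
def riem {m n : ℕ} (F : (Fin m → ℝ) → (Fin n → ℝ)) (l k i j : Fin m) (x : Fin m → ℝ) : ℝ :=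
  pd (fun y => chr F l j k y) i x - pd (fun y => chr F l i k y) j x
    + ∑ p, (chr F l i p x * chr F p j k x - chr F l j p x * chr F p i k x)

/-- Riemann curvature tensor with all indices lowered, `R_{ijkl} = g_{ip} R^p_{jkl}`. -/
def riemLow {m n : ℕ} (F : (Fin m → ℝ) → (Fin n → ℝ)) (i j k l : Fin m) (x : Fin m → ℝ) : ℝ :=
  ∑ p, gInd F i p x * riem F p j k l x

/-- Ricci curvature `R_{ij} = R^k_{ikj}` of the induced metric. -/
def ricci {m n : ℕ} (F : (Fin m → ℝ) → (Fin n → ℝ)) (i j : Fin m) (x : Fin m → ℝ) : ℝ :=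
  ∑ k, riem F k i k j x

/-- Tangential projector `T^α_β = g^{ij} F^α_i F^β_j` onto the tangent space. -/
def tanP {m n : ℕ} (F : (Fin m → ℝ) → (Fin n → ℝ)) (α β : Fin n) (x : Fin m → ℝ) : ℝ :=
  ∑ i, ∑ j, gInv F i j x * Fd F α i x * Fd F β j x

/-- Normal projector `N = id - T` onto the normal bundle. -/
def norP {m n : ℕ} (F : (Fin m → ℝ) → (Fin n → ℝ)) (α β : Fin n) (x : Fin m → ℝ) : ℝ :=
  (if α = β then 1 else 0) - tanP F α β x

/-- Derivative of the normal projector. -/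
def dnorP {m n : ℕ} (F : (Fin m → ℝ) → (Fin n → ℝ)) (i : Fin m) (α β : Fin n)
    (x : Fin m → ℝ) : ℝ :=
  pd (fun y => norP F α β y) i x

/-- Curvature `R^{αβ}_{ij}` of the normal connection (the connection `N ∘ d` on the
normal bundle `im N`), given by the standard formula `N (∂_i N ∂_j N - ∂_j N ∂_i N) N`. -/
def normCurv {m n : ℕ} (F : (Fin m → ℝ) → (Fin n → ℝ)) (α β : Fin n) (i j : Fin m)
    (x : Fin m → ℝ) : ℝ :=
  ∑ γ, ∑ δ, ∑ ε,
    norP F α γ x * (dnorP F i γ δ x * dnorP F j δ ε x - dnorP F j γ δ x * dnorP F i δ ε x)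
      * norP F ε β x

/-- Covariant derivative `∇_l A^α_{ij}` of the second fundamental form, using the full
induced connection (the pullback connection on `F⁻¹Tℝⁿ` is flat in cartesian coordinates). -/
def covA {m n : ℕ} (F : (Fin m → ℝ) → (Fin n → ℝ)) (l : Fin m) (α : Fin n) (i j : Fin m)
    (x : Fin m → ℝ) : ℝ :=
  pd (fun y => sff F α i j y) l x - ∑ k, chr F k l i x * sff F α k j x
    - ∑ k, chr F k l j x * sff F α i k x

/-- Second covariant derivative `∇_p ∇_l A^α_{ij}`. -/
def cov2A {m n : ℕ} (F : (Fin m → ℝ) → (Fin n → ℝ)) (p l : Fin m) (α : Fin n) (i j : Fin m)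
    (x : Fin m → ℝ) : ℝ :=
  pd (fun y => covA F l α i j y) p x - ∑ k, chr F k p l x * covA F k α i j x
    - ∑ k, chr F k p i x * covA F l α k j x - ∑ k, chr F k p j x * covA F l α i k x

/-- Covariant Hessian `∇_l ∇_k H^α` of the mean curvature vector. -/
def hessH {m n : ℕ} (F : (Fin m → ℝ) → (Fin n → ℝ)) (α : Fin n) (l k : Fin m)
    (x : Fin m → ℝ) : ℝ :=
  pd (fun y => pd (fun z => mcv F α z) k y) l x - ∑ p, chr F p l k x * pd (fun z => mcv F α z) p x

/-- Covariant derivative `∇_l R_{ij}` of the Ricci tensor. -/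
def covRic {m n : ℕ} (F : (Fin m → ℝ) → (Fin n → ℝ)) (l i j : Fin m) (x : Fin m → ℝ) : ℝ :=
  pd (fun y => ricci F i j y) l x - ∑ p, chr F p l i x * ricci F p j x
    - ∑ p, chr F p l j x * ricci F i p x

/-- The tensor `a_{ij} = g_{αβ} H^α A^β_{ij}`. -/
def aT {m n : ℕ} (F : (Fin m → ℝ) → (Fin n → ℝ)) (i j : Fin m) (x : Fin m → ℝ) : ℝ :=
  ∑ α, mcv F α x * sff F α i j x

/-- The tensor `b_{ij} = g_{αβ} A^α_{ik} A^{βk}_j`. -/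
def bT {m n : ℕ} (F : (Fin m → ℝ) → (Fin n → ℝ)) (i j : Fin m) (x : Fin m → ℝ) : ℝ :=
  ∑ α, ∑ k, ∑ l, gInv F k l x * sff F α i k x * sff F α j l x

/-- Squared norm `|H|²` of the mean curvature vector. -/
def normH2 {m n : ℕ} (F : (Fin m → ℝ) → (Fin n → ℝ)) (x : Fin m → ℝ) : ℝ :=
  ∑ α, (mcv F α x) ^ 2

/-- Squared norm `|A|²` of the second fundamental form. -/
def normA2 {m n : ℕ} (F : (Fin m → ℝ) → (Fin n → ℝ)) (x : Fin m → ℝ) : ℝ :=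
  ∑ α, ∑ i, ∑ j, ∑ k, ∑ l,
    gInv F i k x * gInv F j l x * sff F α i j x * sff F α k l x

/-- Squared norm `|a_{ij}|²`. -/
def normaT2 {m n : ℕ} (F : (Fin m → ℝ) → (Fin n → ℝ)) (x : Fin m → ℝ) : ℝ :=
  ∑ i, ∑ j, ∑ k, ∑ l, gInv F i k x * gInv F j l x * aT F i j x * aT F k l x

/-- Components `∇_i H^α + a_i^l F^α_l` of the normal covariant derivative of `H`. -/
def nperpH {m n : ℕ} (F : (Fin m → ℝ) → (Fin n → ℝ)) (i : Fin m) (α : Fin n)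
    (x : Fin m → ℝ) : ℝ :=
  pd (fun y => mcv F α y) i x + ∑ l, ∑ k, gInv F l k x * aT F i k x * Fd F α l x

/-- Squared norm `|∇^⊥ H|²`. -/
def normNperpH2 {m n : ℕ} (F : (Fin m → ℝ) → (Fin n → ℝ)) (x : Fin m → ℝ) : ℝ :=
  ∑ α, ∑ i, ∑ j, gInv F i j x * nperpH F i α x * nperpH F j α x

/-- Components `∇_l A^α_{ij} + A^β_{ij} A^k_{βl} F^α_k` of the normal covariant
derivative of `A`. -/
def nperpA {m n : ℕ} (F : (Fin m → ℝ) → (Fin n → ℝ)) (l : Fin m) (α : Fin n) (i j : Fin m)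
    (x : Fin m → ℝ) : ℝ :=
  covA F l α i j x + ∑ β, ∑ k, ∑ p, sff F β i j x * gInv F k p x * sff F β p l x * Fd F α k x

/-- Squared norm `|∇^⊥ A|²`. -/
def normNperpA2 {m n : ℕ} (F : (Fin m → ℝ) → (Fin n → ℝ)) (x : Fin m → ℝ) : ℝ :=
  ∑ α, ∑ l, ∑ l', ∑ i, ∑ i', ∑ j, ∑ j',
    gInv F l l' x * gInv F i i' x * gInv F j j' x * nperpA F l α i j x * nperpA F l' α i' j' x

/-- The symmetric bilinear form `S^{αβ} = A^{αm}_n A^{βn}_m` on the normal bundle. -/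
def ssf {m n : ℕ} (F : (Fin m → ℝ) → (Fin n → ℝ)) (α β : Fin n) (x : Fin m → ℝ) : ℝ :=
  ∑ i, ∑ j, (∑ k, gInv F i k x * sff F α k j x) * (∑ p, gInv F j p x * sff F β p i x)

/-- Squared norm `|A^{αm}_n A^{βn}_m|²`. -/
def normSsf2 {m n : ℕ} (F : (Fin m → ℝ) → (Fin n → ℝ)) (x : Fin m → ℝ) : ℝ :=
  ∑ α, ∑ β, (ssf F α β x) ^ 2

/-- Squared norm `|R^⊥|²` of the normal curvature. -/
def normRperp2 {m n : ℕ} (F : (Fin m → ℝ) → (Fin n → ℝ)) (x : Fin m → ℝ) : ℝ :=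
  ∑ α, ∑ β, ∑ i, ∑ j, ∑ k, ∑ l,
    gInv F i k x * gInv F j l x * normCurv F α β i j x * normCurv F α β k l x

/-- Riemannian volume density `√(det g)`. -/
def volDens {m n : ℕ} (F : (Fin m → ℝ) → (Fin n → ℝ)) (x : Fin m → ℝ) : ℝ :=
  Real.sqrt (gMat F x).det

/-- Laplace–Beltrami operator on scalar functions, `Δf = g^{ij}(∂_i∂_j f - Γ^k_{ij} ∂_k f)`. -/
def lapBel {m n : ℕ} (F : (Fin m → ℝ) → (Fin n → ℝ)) (f : (Fin m → ℝ) → ℝ)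
    (x : Fin m → ℝ) : ℝ :=
  ∑ i, ∑ j, gInv F i j x * (pd (fun y => pd f i y) j x - ∑ k, chr F k i j x * pd f k x)

section Simons

open scoped ContDiff Matrix

section PartialDerivatives

variable {m : ℕ} {f g : (Fin m → ℝ) → ℝ}

theorem contDiff_pd (hf : ContDiff ℝ ∞ f) (i : Fin m) : ContDiff ℝ ∞ (pd f i) :=
  (hf.fderiv_right (m := ∞) (by simp)).clm_apply contDiff_const

theorem pd_sub (hf : ContDiff ℝ ∞ f) (hg : ContDiff ℝ ∞ g) (i : Fin m) (x : Fin m → ℝ) :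
    pd (fun y => f y - g y) i x = pd f i x - pd g i x := by
  unfold pd
  rw [fderiv_fun_sub (hf.differentiable (by simp) x) (hg.differentiable (by simp) x)]
  rfl

theorem pd_mul (hf : ContDiff ℝ ∞ f) (hg : ContDiff ℝ ∞ g) (i : Fin m) (x : Fin m → ℝ) :
    pd (fun y => f y * g y) i x = pd f i x * g x + f x * pd g i x := by
  unfold pd
  rw [fderiv_fun_mul (hf.differentiable (by simp) x) (hg.differentiable (by simp) x)]
  simp
  ring

theorem pd_sum {ι : Type*} {s : Finset ι} {f : ι → (Fin m → ℝ) → ℝ}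
    (hf : ∀ a, ContDiff ℝ ∞ (f a)) (i : Fin m) (x : Fin m → ℝ) :
    pd (fun y => ∑ a ∈ s, f a y) i x = ∑ a ∈ s, pd (f a) i x := by
  unfold pd
  rw [fderiv_fun_sum fun a _ => (hf a).differentiable (by simp) x]
  simp

theorem pd_const (c : ℝ) (i : Fin m) (x : Fin m → ℝ) : pd (fun _ => c) i x = 0 := by
  simp [pd]

theorem pd_comm (hf : ContDiff ℝ ∞ f) (i j : Fin m) (x : Fin m → ℝ) :
    pd (pd f j) i x = pd (pd f i) j x := by
  have hd : DifferentiableAt ℝ (fderiv ℝ f) x :=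
    (hf.fderiv_right (m := ∞) (by simp)).differentiable (by simp) x
  have key (v w : Fin m → ℝ) :
      fderiv ℝ (fun y => fderiv ℝ f y v) x w = fderiv ℝ (fderiv ℝ f) x w v := by
    rw [fderiv_clm_apply hd (differentiableAt_const v)]
    simp
  have hs : IsSymmSndFDerivAt ℝ f x :=
    hf.contDiffAt.isSymmSndFDerivAt (by
      simpa using (WithTop.coe_le_coe.2 le_top : ((2 : ℕ∞) : ℕ∞ω) ≤ ((⊤ : ℕ∞) : ℕ∞ω)))
  change fderiv ℝ (fun y => fderiv ℝ f y _) x _ = fderiv ℝ (fun y => fderiv ℝ f y _) x _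
  rw [key, key, hs.eq]

end PartialDerivatives

section MatrixFields

variable {m : ℕ} {ι κ τ : Type*}

/-- A matrix field all of whose entries are smooth. -/
def SmoothMat (T : (Fin m → ℝ) → Matrix ι κ ℝ) : Prop :=
  ∀ a b, ContDiff ℝ ∞ fun y => T y a b

/-- Entrywise partial derivative of a matrix field. -/
def matD (T : (Fin m → ℝ) → Matrix ι κ ℝ) (i : Fin m) (x : Fin m → ℝ) : Matrix ι κ ℝ :=
  Matrix.of fun a b => pd (fun y => T y a b) i x

variable {T U : (Fin m → ℝ) → Matrix ι κ ℝ}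

theorem SmoothMat.matD (hT : SmoothMat T) (i : Fin m) : SmoothMat (matD T i) :=
  fun a b => contDiff_pd (hT a b) i

theorem SmoothMat.sub (hT : SmoothMat T) (hU : SmoothMat U) :
    SmoothMat fun y => T y - U y :=
  fun a b => (hT a b).sub (hU a b)

theorem SmoothMat.transpose (hT : SmoothMat T) : SmoothMat fun y => (T y)ᵀ :=
  fun a b => hT b a

theorem SmoothMat.mul [Fintype κ] {S : (Fin m → ℝ) → Matrix κ τ ℝ} (hT : SmoothMat T)
    (hS : SmoothMat S) : SmoothMat fun y => T y * S y := by
  intro a b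
  simp only [Matrix.mul_apply]
  exact ContDiff.sum fun k _ => (hT a k).mul (hS k b)

theorem SmoothMat.det [Fintype ι] [DecidableEq ι] {T : (Fin m → ℝ) → Matrix ι ι ℝ}
    (hT : SmoothMat T) : ContDiff ℝ ∞ fun y => (T y).det := by
  simp only [Matrix.det_apply]
  exact ContDiff.sum fun s _ => (contDiff_prod fun i _ => hT _ _).const_smul _

theorem SmoothMat.inv [Fintype ι] [DecidableEq ι] {T : (Fin m → ℝ) → Matrix ι ι ℝ}
    (hT : SmoothMat T) (hdet : ∀ y, (T y).det ≠ 0) : SmoothMat fun y => (T y)⁻¹ := by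
  intro a b
  simp only [Matrix.inv_def, Matrix.smul_apply, Matrix.adjugate_apply, Ring.inverse_eq_inv',
    smul_eq_mul]
  refine (hT.det.inv hdet).mul (SmoothMat.det fun c d => ?_)
  by_cases h : c = b
  · subst h
    simp only [Matrix.updateRow_self]
    exact contDiff_const
  · simp only [Matrix.updateRow_ne h]
    exact hT c d

theorem matD_sub (hT : SmoothMat T) (hU : SmoothMat U) (i : Fin m) (x : Fin m → ℝ) :
    matD (fun y => T y - U y) i x = matD T i x - matD U i x := by
  ext a b
  exact pd_sub (hT a b) (hU a b) i x

theorem matD_transpose (i : Fin m) (x : Fin m → ℝ) :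
    matD (fun y => (T y)ᵀ) i x = (matD T i x)ᵀ := rfl

theorem matD_mul [Fintype κ] {S : (Fin m → ℝ) → Matrix κ τ ℝ} (hT : SmoothMat T)
    (hS : SmoothMat S) (i : Fin m) (x : Fin m → ℝ) :
    matD (fun y => T y * S y) i x = matD T i x * S x + T x * matD S i x := by
  ext a b
  simp only [matD, Matrix.of_apply, Matrix.mul_apply, Matrix.add_apply]
  rw [pd_sum fun k => (hT a k).mul (hS k b), ← sum_add_distrib]
  exact sum_congr rfl fun k _ => pd_mul (hT a k) (hS k b) i x

theorem matD_comm (hT : SmoothMat T) (i j : Fin m) (x : Fin m → ℝ) :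
    matD (matD T j) i x = matD (matD T i) j x := by
  ext a b
  exact pd_comm (hT a b) i j x

end MatrixFields

section Geometry

variable {m n : ℕ} {F : (Fin m → ℝ) → (Fin n → ℝ)}

/-- The transposed Jacobian of `F`, with rows `∂_i F`. -/
def jac (F : (Fin m → ℝ) → (Fin n → ℝ)) (x : Fin m → ℝ) : Matrix (Fin m) (Fin n) ℝ :=
  Matrix.of fun i α => Fd F α i x

/-- Connection matrix of the Levi-Civita connection in direction `i`. -/
def conn (F : (Fin m → ℝ) → (Fin n → ℝ)) (i : Fin m) (x : Fin m → ℝ) :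
    Matrix (Fin m) (Fin m) ℝ :=
  Matrix.of fun k j => chr F k i j x

/-- The `α` component of the second fundamental form as a matrix. -/
def sffMat (F : (Fin m → ℝ) → (Fin n → ℝ)) (α : Fin n) (x : Fin m → ℝ) :
    Matrix (Fin m) (Fin m) ℝ :=
  Matrix.of fun i j => sff F α i j x

theorem contDiff_Fd (hF : ContDiff ℝ ∞ F) (α : Fin n) (i : Fin m) :
    ContDiff ℝ ∞ (Fd F α i) :=
  contDiff_pd (contDiff_pi.1 hF α) i

theorem smoothMat_jac (hF : ContDiff ℝ ∞ F) : SmoothMat (jac F) :=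
  fun i α => contDiff_Fd hF α i

theorem contDiff_gInd (hF : ContDiff ℝ ∞ F) (i j : Fin m) : ContDiff ℝ ∞ (gInd F i j) :=
  ContDiff.sum fun α _ => (contDiff_Fd hF α i).mul (contDiff_Fd hF α j)

theorem smoothMat_gMat (hF : ContDiff ℝ ∞ F) : SmoothMat (gMat F) :=
  fun i j => contDiff_gInd hF i j

theorem smoothMat_gInv (hF : ContDiff ℝ ∞ F) (himm : ∀ x, (gMat F x).det ≠ 0) :
    SmoothMat fun y => (gMat F y)⁻¹ :=
  SmoothMat.inv (smoothMat_gMat hF) himm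

theorem contDiff_chr (hF : ContDiff ℝ ∞ F) (himm : ∀ x, (gMat F x).det ≠ 0) (k i j : Fin m) :
    ContDiff ℝ ∞ (chr F k i j) :=
  contDiff_const.mul <| ContDiff.sum fun l _ => (smoothMat_gInv hF himm k l).mul <|
    ((contDiff_pd (contDiff_gInd hF l j) i).add (contDiff_pd (contDiff_gInd hF l i) j)).sub
      (contDiff_pd (contDiff_gInd hF i j) l)

theorem smoothMat_conn (hF : ContDiff ℝ ∞ F) (himm : ∀ x, (gMat F x).det ≠ 0) (i : Fin m) :
    SmoothMat (conn F i) :=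
  fun k j => contDiff_chr hF himm k i j

theorem contDiff_sff (hF : ContDiff ℝ ∞ F) (himm : ∀ x, (gMat F x).det ≠ 0) (α : Fin n)
    (i j : Fin m) : ContDiff ℝ ∞ (sff F α i j) :=
  (contDiff_pd (contDiff_Fd hF α j) i).sub <|
    ContDiff.sum fun k _ => (contDiff_chr hF himm k i j).mul (contDiff_Fd hF α k)

theorem contDiff_covA (hF : ContDiff ℝ ∞ F) (himm : ∀ x, (gMat F x).det ≠ 0) (l : Fin m)
    (α : Fin n) (i j : Fin m) : ContDiff ℝ ∞ (covA F l α i j) :=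
  ((contDiff_pd (contDiff_sff hF himm α i j) l).sub <|
    ContDiff.sum fun k _ => (contDiff_chr hF himm k l i).mul (contDiff_sff hF himm α k j)).sub <|
    ContDiff.sum fun k _ => (contDiff_chr hF himm k l j).mul (contDiff_sff hF himm α i k)

theorem gInd_symm (i j : Fin m) : gInd F i j = gInd F j i := by
  funext x
  exact sum_congr rfl fun α _ => mul_comm _ _

theorem gInv_symm (i j : Fin m) (x : Fin m → ℝ) : gInv F i j x = gInv F j i x := by
  have h : (gMat F x)ᵀ = gMat F x := by
    ext a b
    exact congrFun (gInd_symm b a) x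
  have := congrFun (congrFun (Matrix.transpose_nonsing_inv (gMat F x)) j) i
  rwa [h] at this

theorem chr_symm (k i j : Fin m) : chr F k i j = chr F k j i := by
  funext x
  unfold chr
  congr 1
  refine sum_congr rfl fun l _ => ?_
  rw [gInd_symm i j]
  ring

theorem pd_Fd_symm (hF : ContDiff ℝ ∞ F) (α : Fin n) (i j : Fin m) :
    pd (Fd F α j) i = pd (Fd F α i) j := by
  funext x
  exact pd_comm (contDiff_pi.1 hF α) i j x

theorem sff_symm (hF : ContDiff ℝ ∞ F) (α : Fin n) (i j : Fin m) :
    sff F α i j = sff F α j i := by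
  funext x
  unfold sff
  simp only [chr_symm _ i j]
  congr 1
  exact congrFun (pd_Fd_symm hF α i j) x

theorem covA_symm (hF : ContDiff ℝ ∞ F) (l : Fin m) (α : Fin n) (i j : Fin m) :
    covA F l α i j = covA F l α j i := by
  funext x
  unfold covA
  simp only [sff_symm hF α _ j, sff_symm hF α i _]
  ring

theorem cov2A_symm (hF : ContDiff ℝ ∞ F) (p l : Fin m) (α : Fin n) (i j : Fin m)
    (x : Fin m → ℝ) : cov2A F p l α i j x = cov2A F p l α j i x := by
  unfold cov2A
  simp only [covA_symm hF _ α _ j, covA_symm hF _ α i _]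
  ring

theorem pd_gInd (hF : ContDiff ℝ ∞ F) (i j k : Fin m) (x : Fin m → ℝ) :
    pd (gInd F i j) k x = ∑ α, (pd (Fd F α i) k x * Fd F α j x + Fd F α i x * pd (Fd F α j) k x) := by
  unfold gInd
  rw [pd_sum fun α => (contDiff_Fd hF α i).mul (contDiff_Fd hF α j)]
  exact sum_congr rfl fun α _ => pd_mul (contDiff_Fd hF α i) (contDiff_Fd hF α j) k x

theorem sum_gInd_mul_gInv (himm : ∀ x, (gMat F x).det ≠ 0) (i j : Fin m) (x : Fin m → ℝ) :
    ∑ k, gInd F i k x * gInv F k j x = if i = j then 1 else 0 := by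
  have := congrFun (congrFun (Matrix.mul_nonsing_inv (gMat F x) (himm x).isUnit) i) j
  rwa [Matrix.mul_apply, Matrix.one_apply] at this

theorem sum_gInv_mul_gInd (himm : ∀ x, (gMat F x).det ≠ 0) (i j : Fin m) (x : Fin m → ℝ) :
    ∑ k, gInv F i k x * gInd F k j x = if i = j then 1 else 0 := by
  have := congrFun (congrFun (Matrix.nonsing_inv_mul (gMat F x) (himm x).isUnit) i) j
  rwa [Matrix.mul_apply, Matrix.one_apply] at this

theorem sum_gInd_mul_chr (hF : ContDiff ℝ ∞ F) (himm : ∀ x, (gMat F x).det ≠ 0)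
    (k i j : Fin m) (x : Fin m → ℝ) :
    ∑ p, gInd F k p x * chr F p i j x = ∑ α, pd (Fd F α j) i x * Fd F α k x := by
  have h1 (c : Fin m → ℝ) :
      ∑ p, gInd F k p x * (1 / 2 * ∑ l, gInv F p l x * c l) = 1 / 2 * c k := by
    have : ∑ p, gInd F k p x * (1 / 2 * ∑ l, gInv F p l x * c l)
        = 1 / 2 * ∑ l, (∑ p, gInd F k p x * gInv F p l x) * c l := by
      simp only [mul_sum, sum_mul]
      rw [sum_comm]
      exact sum_congr rfl fun _ _ => sum_congr rfl fun _ _ => by ring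
    rw [this]
    simp [sum_gInd_mul_gInv himm]
  unfold chr
  rw [h1, pd_gInd hF, pd_gInd hF, pd_gInd hF, ← sum_add_distrib, ← sum_sub_distrib, mul_sum]
  refine sum_congr rfl fun α _ => ?_
  rw [pd_Fd_symm hF α i k, pd_Fd_symm hF α j k, pd_Fd_symm hF α j i]
  ring

/-- The second fundamental form is normal. -/
theorem sum_sff_mul_Fd (hF : ContDiff ℝ ∞ F) (himm : ∀ x, (gMat F x).det ≠ 0)
    (i j k : Fin m) (x : Fin m → ℝ) : ∑ α, sff F α i j x * Fd F α k x = 0 := by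
  have h := sum_gInd_mul_chr hF himm k i j x
  simp only [sff, sub_mul, sum_sub_distrib]
  refine sub_eq_zero.2 (h.symm.trans ?_)
  simp only [gInd, sum_mul]
  rw [sum_comm]
  exact sum_congr rfl fun _ _ => sum_congr rfl fun _ _ => by ring

theorem pd_Fd (α : Fin n) (i j : Fin m) (x : Fin m → ℝ) :
    pd (Fd F α j) i x = sff F α i j x + ∑ k, chr F k i j x * Fd F α k x := by
  exact (sub_add_cancel _ _).symm

theorem pd_sff (α : Fin n) (l i j : Fin m) (x : Fin m → ℝ) :
    pd (sff F α i j) l x = covA F l α i j x + ∑ k, chr F k l i x * sff F α k j x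
      + ∑ k, chr F k l j x * sff F α i k x := by
  unfold covA
  change _ = pd (sff F α i j) l x - _ - _ + _ + _
  ring

/-- The Weingarten relation. -/
theorem sum_covA_mul_Fd (hF : ContDiff ℝ ∞ F) (himm : ∀ x, (gMat F x).det ≠ 0)
    (l i j k : Fin m) (x : Fin m → ℝ) :
    ∑ α, covA F l α i j x * Fd F α k x = -∑ α, sff F α i j x * sff F α l k x := by
  have h0 : pd (fun y => ∑ α, sff F α i j y * Fd F α k y) l x = 0 := by
    simp only [sum_sff_mul_Fd hF himm, pd_const]
  rw [pd_sum fun α => (contDiff_sff hF himm α i j).mul (contDiff_Fd hF α k)] at h0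
  simp only [pd_mul (contDiff_sff hF himm _ i j) (contDiff_Fd hF _ k), pd_sff, pd_Fd] at h0
  have h1 : ∑ α, (∑ p, chr F p l i x * sff F α p j x) * Fd F α k x = 0 := by
    simp only [sum_mul, mul_assoc]
    rw [sum_comm]
    simp [← mul_sum, sum_sff_mul_Fd hF himm]
  have h2 : ∑ α, (∑ p, chr F p l j x * sff F α i p x) * Fd F α k x = 0 := by
    simp only [sum_mul, mul_assoc]
    rw [sum_comm]
    simp [← mul_sum, sum_sff_mul_Fd hF himm]
  have h3 : ∑ α, sff F α i j x * ∑ p, chr F p l k x * Fd F α p x = 0 := by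
    simp only [mul_sum, mul_left_comm]
    rw [sum_comm]
    simp [← mul_sum, sum_sff_mul_Fd hF himm]
  simp only [add_mul, mul_add, sum_add_distrib, h1, h2, h3] at h0
  linarith

theorem sffMat_eq (α : Fin n) (x : Fin m → ℝ) (i j : Fin m) :
    (matD (jac F) i x - (conn F i x)ᵀ * jac F x) j α = sff F α i j x := by
  simp [matD, jac, conn, sff, Matrix.mul_apply]

theorem riem_eq (l k i j : Fin m) (x : Fin m → ℝ) :
    (matD (conn F j) i x - matD (conn F i) j x + (conn F i x * conn F j x
      - conn F j x * conn F i x)) l k = riem F l k i j x := by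
  simp [matD, conn, riem, Matrix.mul_apply]

/-- The Codazzi equation. -/
theorem covA_sub_covA (hF : ContDiff ℝ ∞ F) (himm : ∀ x, (gMat F x).det ≠ 0)
    (i j k : Fin m) (α : Fin n) (x : Fin m → ℝ) :
    covA F i α j k x - covA F j α i k x = -∑ p, riem F p k i j x * Fd F α p x := by
  have hJ := smoothMat_jac hF
  have hK := smoothMat_conn hF himm
  have hD (i j : Fin m) : matD (fun y => matD (jac F) j y - (conn F j y)ᵀ * jac F y) i x
      = matD (matD (jac F) j) i x
        - ((matD (conn F j) i x)ᵀ * jac F x + (conn F j x)ᵀ * matD (jac F) i x) := by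
    rw [matD_sub (hJ.matD j) ((hK j).transpose.mul hJ), matD_mul (hK j).transpose hJ,
      matD_transpose]
  have hcov (i j : Fin m) : covA F i α j k x =
      (matD (fun y => matD (jac F) j y - (conn F j y)ᵀ * jac F y) i x
        - (conn F i x)ᵀ * (matD (jac F) j x - (conn F j x)ᵀ * jac F x)) k α
        - ∑ r, chr F r i j x * sff F α r k x := by
    have hpd : pd (sff F α j k) i x
        = matD (fun y => matD (jac F) j y - (conn F j y)ᵀ * jac F y) i x k α := by
      simp only [matD, Matrix.of_apply]
      exact congrArg (fun T => pd T i x) (funext fun y => (sffMat_eq α y j k).symm)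
    rw [Matrix.sub_apply, ← hpd, Matrix.mul_apply]
    simp only [sffMat_eq]
    simp only [Matrix.transpose_apply, conn, Matrix.of_apply]
    unfold covA
    ring
  have hR : -∑ p, riem F p k i j x * Fd F α p x
      = (-((matD (conn F j) i x - matD (conn F i) j x + (conn F i x * conn F j x
      - conn F j x * conn F i x))ᵀ * jac F x)) k α := by
    simp only [Matrix.neg_apply, Matrix.mul_apply, Matrix.transpose_apply, riem_eq]
    rfl
  rw [hcov i j, hcov j i, hR]
  simp only [chr_symm _ i j]
  rw [sub_sub_sub_cancel_right, ← Matrix.sub_apply, hD, hD, matD_comm hJ i j]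
  refine congrFun (congrFun ?_ k) α
  simp only [Matrix.mul_sub, Matrix.sub_mul, Matrix.add_mul, Matrix.transpose_add,
    Matrix.transpose_sub, Matrix.transpose_mul, Matrix.mul_assoc]
  abel

/-- The Gauss equation. -/
theorem riemLow_eq (hF : ContDiff ℝ ∞ F) (himm : ∀ x, (gMat F x).det ≠ 0)
    (a k i j : Fin m) (x : Fin m → ℝ) :
    riemLow F a k i j x
      = ∑ α, (sff F α i a x * sff F α j k x - sff F α i k x * sff F α j a x) := by
  have h : ∑ α, (covA F i α j k x - covA F j α i k x) * Fd F α a x = - riemLow F a k i j x := by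
    simp only [covA_sub_covA hF himm, riemLow, gInd, neg_mul, sum_neg_distrib, sum_mul]
    rw [sum_comm]
    exact congrArg _ <| sum_congr rfl fun _ _ => sum_congr rfl fun _ _ => by ring
  simp only [sub_mul, sum_sub_distrib, sum_covA_mul_Fd hF himm] at h
  rw [sum_sub_distrib]
  simp only [mul_comm (sff F _ i a x)]
  linarith

theorem riem_eq_sum (himm : ∀ x, (gMat F x).det ≠ 0) (l k i j : Fin m) (x : Fin m → ℝ) :
    riem F l k i j x = ∑ a, gInv F l a x * riemLow F a k i j x := by
  simp only [riemLow, mul_sum]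
  rw [sum_comm]
  simp only [← mul_assoc, ← sum_mul, sum_gInv_mul_gInd himm]
  simp

/-- Metric compatibility of the Levi-Civita connection. -/
theorem matD_gMat (hF : ContDiff ℝ ∞ F) (himm : ∀ x, (gMat F x).det ≠ 0) (i : Fin m)
    (x : Fin m → ℝ) :
    matD (gMat F) i x = (conn F i x)ᵀ * gMat F x + gMat F x * conn F i x := by
  ext a b
  have h1 : ((conn F i x)ᵀ * gMat F x) a b = ∑ α, pd (Fd F α a) i x * Fd F α b x := by
    rw [← sum_gInd_mul_chr hF himm, Matrix.mul_apply]
    refine sum_congr rfl fun p _ => ?_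
    rw [gInd_symm b p, mul_comm]
    rfl
  have h2 : (gMat F x * conn F i x) a b = ∑ α, pd (Fd F α b) i x * Fd F α a x := by
    rw [← sum_gInd_mul_chr hF himm, Matrix.mul_apply]
    rfl
  rw [Matrix.add_apply, h1, h2, ← sum_add_distrib]
  refine (pd_gInd hF a b i x).trans (sum_congr rfl fun α _ => by ring)

theorem matD_gInv (hF : ContDiff ℝ ∞ F) (himm : ∀ x, (gMat F x).det ≠ 0) (i : Fin m)
    (x : Fin m → ℝ) :
    matD (fun y => (gMat F y)⁻¹) i x
      = -(conn F i x * (gMat F x)⁻¹) - (gMat F x)⁻¹ * (conn F i x)ᵀ := by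
  have hu := (himm x).isUnit
  have h0 : matD (fun y => gMat F y * (gMat F y)⁻¹) i x = 0 := by
    simp only [Matrix.mul_nonsing_inv _ (himm _).isUnit]
    ext a b
    exact pd_const _ i x
  rw [matD_mul (smoothMat_gMat hF) (smoothMat_gInv hF himm),
    matD_gMat hF himm] at h0
  have h1 := congrArg ((gMat F x)⁻¹ * ·) h0
  simp only [Matrix.mul_add, Matrix.add_mul, Matrix.mul_assoc, Matrix.mul_nonsing_inv _ hu,
    Matrix.nonsing_inv_mul_cancel_left _ _ hu, Matrix.mul_one, Matrix.mul_zero] at h1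
  rw [← sub_eq_zero, ← h1]
  abel

theorem covA_eq (l : Fin m) (α : Fin n) (x : Fin m → ℝ) :
    (Matrix.of fun i j => covA F l α i j x) = matD (sffMat F α) l x
      - (conn F l x)ᵀ * sffMat F α x - sffMat F α x * conn F l x := by
  ext i j
  simp only [covA, matD, sffMat, conn, Matrix.mul_apply, Matrix.sub_apply, Matrix.of_apply,
    Matrix.transpose_apply]
  congr 1
  exact sum_congr rfl fun _ _ => mul_comm _ _

/-- The Ricci identity for the second fundamental form. -/
theorem cov2A_sub_cov2A (hF : ContDiff ℝ ∞ F) (himm : ∀ x, (gMat F x).det ≠ 0)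
    (p l q k : Fin m) (α : Fin n) (x : Fin m → ℝ) :
    cov2A F p l α q k x - cov2A F l p α q k x
      = -∑ r, riem F r q p l x * sff F α r k x - ∑ r, riem F r k p l x * sff F α q r x := by
  have hS : SmoothMat (sffMat F α) := fun i j => contDiff_sff hF himm α i j
  have hK := smoothMat_conn hF himm
  let B (l : Fin m) (y : Fin m → ℝ) : Matrix (Fin m) (Fin m) ℝ :=
    matD (sffMat F α) l y - (conn F l y)ᵀ * sffMat F α y - sffMat F α y * conn F l y
  have hB (l : Fin m) (y : Fin m → ℝ) (i j : Fin m) : covA F l α i j y = B l y i j :=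
    congrFun (congrFun (covA_eq l α y) i) j
  have hcov (p l : Fin m) : cov2A F p l α q k x = (matD (B l) p x - (conn F p x)ᵀ * B l x
      - B l x * conn F p x) q k - ∑ r, chr F r p l x * covA F r α q k x := by
    simp only [cov2A, hB, Matrix.sub_apply, Matrix.mul_apply, Matrix.transpose_apply, conn,
      matD, Matrix.of_apply, mul_comm (B l x q _)]
    ring
  have hD (p l : Fin m) : matD (B l) p x = matD (matD (sffMat F α) l) p x
      - ((matD (conn F l) p x)ᵀ * sffMat F α x + (conn F l x)ᵀ * matD (sffMat F α) p x)
      - (matD (sffMat F α) p x * conn F l x + sffMat F α x * matD (conn F l) p x) := by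
    rw [matD_sub ((hS.matD l).sub ((hK l).transpose.mul hS)) (hS.mul (hK l)),
      matD_sub (hS.matD l) ((hK l).transpose.mul hS), matD_mul (hK l).transpose hS,
      matD_mul hS (hK l), matD_transpose]
  have hR : -∑ r, riem F r q p l x * sff F α r k x - ∑ r, riem F r k p l x * sff F α q r x
      = (-((matD (conn F l) p x - matD (conn F p) l x + (conn F p x * conn F l x
        - conn F l x * conn F p x))ᵀ * sffMat F α x)
        - sffMat F α x * (matD (conn F l) p x - matD (conn F p) l x + (conn F p x * conn F l x
        - conn F l x * conn F p x))) q k := by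
    rw [Matrix.sub_apply, Matrix.neg_apply, Matrix.mul_apply, Matrix.mul_apply]
    simp only [Matrix.transpose_apply, riem_eq, mul_comm (sffMat F α x q _)]
    rfl
  rw [hcov p l, hcov l p, hR]
  simp only [chr_symm _ p l]
  rw [sub_sub_sub_cancel_right, ← Matrix.sub_apply, hD, hD, matD_comm hS p l]
  refine congrFun (congrFun ?_ q) k
  simp only [B, Matrix.mul_sub, Matrix.sub_mul, Matrix.mul_add, Matrix.add_mul,
    Matrix.transpose_add, Matrix.transpose_sub, Matrix.transpose_mul, Matrix.mul_assoc]
  abel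

/-- Trace of a bilinear form with respect to the induced metric. -/
def gTrace (F : (Fin m → ℝ) → (Fin n → ℝ)) (x : Fin m → ℝ) (K : Fin m → Fin m → ℝ) : ℝ :=
  ∑ p, ∑ q, gInv F p q x * K p q

theorem gTrace_add (x : Fin m → ℝ) (K L : Fin m → Fin m → ℝ) :
    gTrace F x (fun p q => K p q + L p q) = gTrace F x K + gTrace F x L := by
  simp only [gTrace, mul_add, sum_add_distrib]

theorem gTrace_sub (x : Fin m → ℝ) (K L : Fin m → Fin m → ℝ) :
    gTrace F x (fun p q => K p q - L p q) = gTrace F x K - gTrace F x L := by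
  simp only [gTrace, mul_sub, sum_sub_distrib]

theorem gTrace_neg (x : Fin m → ℝ) (K : Fin m → Fin m → ℝ) :
    gTrace F x (fun p q => -K p q) = -gTrace F x K := by
  simp only [gTrace, mul_neg, sum_neg_distrib]

theorem mul_gTrace (x : Fin m → ℝ) (c : ℝ) (K : Fin m → Fin m → ℝ) :
    c * gTrace F x K = gTrace F x fun p q => c * K p q := by
  simp only [gTrace, mul_sum, mul_left_comm]

theorem gTrace_mul (x : Fin m → ℝ) (K : Fin m → Fin m → ℝ) (c : ℝ) :
    gTrace F x K * c = gTrace F x fun p q => K p q * c := by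
  simp only [gTrace, sum_mul, mul_assoc]

theorem gTrace_sum {ι : Type*} (s : Finset ι) (x : Fin m → ℝ) (K : ι → Fin m → Fin m → ℝ) :
    gTrace F x (fun p q => ∑ a ∈ s, K a p q) = ∑ a ∈ s, gTrace F x (K a) := by
  simp only [gTrace, mul_sum]
  rw [sum_comm]
  simp only [sum_comm (s := s)]
  rw [sum_comm]

theorem gTrace_swap (x : Fin m → ℝ) (K : Fin m → Fin m → ℝ) :
    gTrace F x (fun p q => K q p) = gTrace F x K := by
  unfold gTrace
  rw [sum_comm]
  exact sum_congr rfl fun p _ => sum_congr rfl fun q _ => by rw [gInv_symm]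

theorem gTrace_comm (x : Fin m → ℝ) (K : Fin m → Fin m → Fin m → Fin m → ℝ) :
    gTrace F x (fun p q => gTrace F x (K p q))
      = gTrace F x fun a b => gTrace F x fun p q => K p q a b := by
  change gTrace F x (fun p q => ∑ a, ∑ b, gInv F a b x * K p q a b) = _
  simp only [gTrace_sum, ← mul_gTrace]
  rfl

theorem mul_gInv_mul_apply {ι κ : Type*} (x : Fin m → ℝ) (M : Matrix ι (Fin m) ℝ)
    (N : Matrix (Fin m) κ ℝ) (i : ι) (j : κ) :
    (M * (gMat F x)⁻¹ * N) i j = gTrace F x fun a b => M i a * N b j := by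
  simp only [Matrix.mul_apply, gTrace, sum_mul]
  rw [sum_comm]
  refine sum_congr rfl fun a _ => sum_congr rfl fun b _ => ?_
  unfold gInv
  ring

theorem pd_gTrace (hF : ContDiff ℝ ∞ F) (himm : ∀ x, (gMat F x).det ≠ 0)
    {T : (Fin m → ℝ) → Matrix (Fin m) (Fin m) ℝ} (hT : SmoothMat T) (l : Fin m)
    (x : Fin m → ℝ) :
    pd (fun y => gTrace F y fun p q => T y p q) l x
      = gTrace F x fun p q => (matD T l x - (conn F l x)ᵀ * T x - T x * conn F l x) p q := by
  have hg := smoothMat_gInv hF himm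
  have htr (y : Fin m → ℝ) (M : Matrix (Fin m) (Fin m) ℝ) :
      (gTrace F y fun p q => M p q) = ((gMat F y)⁻¹ * Mᵀ).trace := by
    simp [gTrace, gInv, Matrix.trace, Matrix.mul_apply]
  have hpd {S : (Fin m → ℝ) → Matrix (Fin m) (Fin m) ℝ} (hS : SmoothMat S) :
      pd (fun y => (S y).trace) l x = (matD S l x).trace :=
    pd_sum (fun a => hS a a) l x
  simp only [htr]
  rw [hpd (hg.mul hT.transpose), matD_mul hg hT.transpose, matD_gInv hF himm, matD_transpose]
  simp only [Matrix.sub_mul, Matrix.neg_mul, Matrix.transpose_sub, Matrix.transpose_mul,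
    Matrix.transpose_transpose, Matrix.mul_sub, Matrix.trace_add, Matrix.trace_sub,
    Matrix.trace_neg, Matrix.mul_assoc]
  rw [Matrix.trace_mul_comm (conn F l x), Matrix.mul_assoc]
  ring

theorem pd_mcv (hF : ContDiff ℝ ∞ F) (himm : ∀ x, (gMat F x).det ≠ 0) (α : Fin n) (l : Fin m)
    (x : Fin m → ℝ) :
    pd (mcv F α) l x = gTrace F x fun p q => covA F l α p q x := by
  refine (pd_gTrace hF himm (T := sffMat F α) (fun i j => contDiff_sff hF himm α i j) l x).trans ?_
  rw [← covA_eq]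
  rfl

theorem contDiff_mcv (hF : ContDiff ℝ ∞ F) (himm : ∀ x, (gMat F x).det ≠ 0) (α : Fin n) :
    ContDiff ℝ ∞ (mcv F α) :=
  ContDiff.sum fun i _ => ContDiff.sum fun j _ =>
    (smoothMat_gInv hF himm i j).mul (contDiff_sff hF himm α i j)

theorem hessH_eq (hF : ContDiff ℝ ∞ F) (himm : ∀ x, (gMat F x).det ≠ 0) (α : Fin n)
    (l k : Fin m) (x : Fin m → ℝ) :
    hessH F α l k x = gTrace F x fun p q => cov2A F l k α p q x := by
  have h : pd (fun z => mcv F α z) k = fun y => gTrace F y fun p q => covA F k α p q y :=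
    funext (pd_mcv hF himm α k)
  have h' := pd_gTrace hF himm (T := fun y => Matrix.of fun p q => covA F k α p q y)
    (fun i j => contDiff_covA hF himm k α i j) l x
  unfold hessH
  change pd (pd (fun z => mcv F α z) k) l x - ∑ p, chr F p l k x * pd (mcv F α) p x = _
  rw [h]
  refine (congrArg (· - _) h').trans ?_
  simp only [pd_mcv hF himm, mul_gTrace]
  rw [← gTrace_sum, ← gTrace_sub]
  congr 1
  funext p q
  simp only [cov2A, matD, conn, Matrix.mul_apply, Matrix.sub_apply, Matrix.of_apply,
    Matrix.transpose_apply, mul_comm (covA F k α p _ x)]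
  ring

/-- Leibniz rule for metric contractions `M g⁻¹ N`. -/
theorem pd_mul_gInv_mul (hF : ContDiff ℝ ∞ F) (himm : ∀ x, (gMat F x).det ≠ 0)
    {ι : Type*} {M : (Fin m → ℝ) → Matrix (Fin m) (Fin m) ℝ}
    {N : (Fin m → ℝ) → Matrix (Fin m) ι ℝ} (hM : SmoothMat M) (hN : SmoothMat N) (l : Fin m)
    (x : Fin m → ℝ) :
    matD (fun y => M y * (gMat F y)⁻¹ * N y) l x
      = (conn F l x)ᵀ * (M x * (gMat F x)⁻¹ * N x)
        + (matD M l x - (conn F l x)ᵀ * M x - M x * conn F l x) * (gMat F x)⁻¹ * N x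
        + M x * (gMat F x)⁻¹ * (matD N l x - (conn F l x)ᵀ * N x) := by
  have hg := smoothMat_gInv hF himm
  rw [matD_mul (hM.mul hg) hN, matD_mul hM hg, matD_gInv hF himm]
  simp only [Matrix.sub_mul, Matrix.mul_sub, Matrix.add_mul, Matrix.mul_neg,
    Matrix.neg_mul, Matrix.mul_assoc]
  abel

/-- The contraction `⟨A_{ij}, A_{kl}⟩`. -/
def sffPair (F : (Fin m → ℝ) → (Fin n → ℝ)) (x : Fin m → ℝ) (i j k l : Fin m) : ℝ :=
  ∑ β, sff F β i j x * sff F β k l x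

/-- The contraction `⟨A_{ij}, ∇_p A_{kl}⟩`. -/
def sffCovPair (F : (Fin m → ℝ) → (Fin n → ℝ)) (x : Fin m → ℝ) (i j p k l : Fin m) : ℝ :=
  ∑ β, sff F β i j x * covA F p β k l x

theorem riemLow_eq_sffPair (hF : ContDiff ℝ ∞ F) (himm : ∀ x, (gMat F x).det ≠ 0)
    (a k i j : Fin m) (x : Fin m → ℝ) :
    riemLow F a k i j x = sffPair F x i a j k - sffPair F x i k j a := by
  rw [riemLow_eq hF himm, sum_sub_distrib]
  rfl

theorem ricci_eq (hF : ContDiff ℝ ∞ F) (himm : ∀ x, (gMat F x).det ≠ 0) (i j : Fin m)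
    (x : Fin m → ℝ) :
    ricci F i j x = gTrace F x fun k a => sffPair F x k a j i - sffPair F x k i j a := by
  simp only [ricci, riem_eq_sum himm, riemLow_eq_sffPair hF himm]
  rfl

theorem ricci_eq_sum (hF : ContDiff ℝ ∞ F) (himm : ∀ x, (gMat F x).det ≠ 0) (i j : Fin m)
    (x : Fin m → ℝ) :
    ricci F i j x = ∑ α, (mcv F α x * sff F α i j x
      - (sffMat F α x * (gMat F x)⁻¹ * sffMat F α x) i j) := by
  rw [ricci_eq hF himm]
  simp only [sffPair, ← sum_sub_distrib, gTrace_sum, mul_gInv_mul_apply]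
  refine sum_congr rfl fun α _ => ?_
  change _ = gTrace F x (fun p q => sff F α p q x) * _ - _
  rw [gTrace_mul, ← gTrace_sub]
  congr 1
  funext p q
  rw [sff_symm hF α j i, sff_symm hF α p i, sff_symm hF α j q]
  rfl

theorem covRic_eq (hF : ContDiff ℝ ∞ F) (himm : ∀ x, (gMat F x).det ≠ 0) (i l k : Fin m)
    (x : Fin m → ℝ) :
    covRic F i l k x = gTrace F x fun p q => sffCovPair F x l k i p q + sffCovPair F x p q i l k
      - sffCovPair F x l p i q k - sffCovPair F x q k i l p := by
  have hS (α : Fin n) : SmoothMat (sffMat F α) := fun i j => contDiff_sff hF himm α i j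
  let W (α : Fin n) (y : Fin m → ℝ) : Matrix (Fin m) (Fin m) ℝ :=
    sffMat F α y * (gMat F y)⁻¹ * sffMat F α y
  have hW (α : Fin n) : SmoothMat (W α) := ((hS α).mul (smoothMat_gInv hF himm)).mul (hS α)
  have hric (a b : Fin m) : ricci F a b
      = fun y => ∑ α, (mcv F α y * sff F α a b y - W α y a b) :=
    funext (ricci_eq_sum hF himm a b)
  have hpdW (α : Fin n) : pd (fun y => W α y l k) i x
      = ∑ r, chr F r i l x * W α x r k + ∑ r, chr F r i k x * W α x l r
        + gTrace F x fun p q => covA F i α l p x * sff F α q k x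
          + sff F α l p x * covA F i α q k x := by
    have h := pd_mul_gInv_mul hF himm (hS α) (hS α) i x
    have h' : matD (W α) i x = (conn F i x)ᵀ * W α x + W α x * conn F i x
        + (Matrix.of (fun a b => covA F i α a b x) * (gMat F x)⁻¹ * sffMat F α x
        + sffMat F α x * (gMat F x)⁻¹ * Matrix.of (fun a b => covA F i α a b x)) := by
      refine h.trans ?_
      rw [covA_eq]
      simp only [W, Matrix.sub_mul, Matrix.mul_sub, Matrix.mul_assoc]
      abel
    have h'' := congrFun (congrFun h' l) k
    simp only [Matrix.add_apply, mul_gInv_mul_apply] at h''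
    rw [← gTrace_add] at h''
    refine h''.trans ?_
    rw [Matrix.mul_apply, Matrix.mul_apply]
    simp only [mul_comm (W α x l _)]
    rfl
  have hpd : pd (ricci F l k) i x = ∑ α, ((gTrace F x fun p q => covA F i α p q x) * sff F α l k x
      + mcv F α x * pd (sff F α l k) i x - pd (fun y => W α y l k) i x) := by
    rw [hric, pd_sum fun α => ((contDiff_mcv hF himm α).mul (contDiff_sff hF himm α l k)).sub
      (hW α l k)]
    refine sum_congr rfl fun α _ => ?_
    rw [pd_sub ((contDiff_mcv hF himm α).mul (contDiff_sff hF himm α l k)) (hW α l k),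
      pd_mul (contDiff_mcv hF himm α) (contDiff_sff hF himm α l k), pd_mcv hF himm]
  unfold covRic
  change pd (ricci F l k) i x - _ - _ = _
  rw [hpd]
  simp only [hric, mul_sum]
  rw [sum_comm, sum_comm (γ := Fin m), ← sum_sub_distrib, ← sum_sub_distrib]
  simp only [sffCovPair, ← sum_add_distrib, ← sum_sub_distrib, gTrace_sum]
  refine sum_congr rfl fun α _ => ?_
  simp only [hpdW, pd_sff, gTrace_add, gTrace_sub, ← mul_gTrace, ← gTrace_mul]
  have hH : mcv F α x = gTrace F x fun p q => sff F α p q x := rfl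
  simp only [← hH, mul_add, mul_sum, mul_sub, sum_sub_distrib]
  simp only [mul_left_comm (mcv F α x), mul_comm (sff F α _ k x) (covA F i α l _ x)]
  ring

theorem sffPair_swap_left (hF : ContDiff ℝ ∞ F) (x : Fin m → ℝ) (i j k l : Fin m) :
    sffPair F x i j k l = sffPair F x j i k l := by
  simp only [sffPair, sff_symm hF _ i j]

theorem sffPair_swap_right (hF : ContDiff ℝ ∞ F) (x : Fin m → ℝ) (i j k l : Fin m) :
    sffPair F x i j k l = sffPair F x i j l k := by
  simp only [sffPair, sff_symm hF _ k l]

theorem sffPair_comm (x : Fin m → ℝ) (i j k l : Fin m) :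
    sffPair F x i j k l = sffPair F x k l i j :=
  sum_congr rfl fun _ _ => mul_comm _ _

theorem sffCovPair_swap_left (hF : ContDiff ℝ ∞ F) (x : Fin m → ℝ) (i j p k l : Fin m) :
    sffCovPair F x i j p k l = sffCovPair F x j i p k l := by
  simp only [sffCovPair, sff_symm hF _ i j]

theorem sffCovPair_swap_right (hF : ContDiff ℝ ∞ F) (x : Fin m → ℝ) (i j p k l : Fin m) :
    sffCovPair F x i j p k l = sffCovPair F x i j p l k := by
  simp only [sffCovPair, covA_symm hF _ _ k l]

/-- The Codazzi equation for the normal part of `∇A`. -/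
theorem sffCovPair_codazzi (hF : ContDiff ℝ ∞ F) (himm : ∀ x, (gMat F x).det ≠ 0)
    (x : Fin m → ℝ) (i j p k l : Fin m) :
    sffCovPair F x i j p k l = sffCovPair F x i j k p l := by
  rw [← sub_eq_zero]
  simp only [sffCovPair, ← sum_sub_distrib, ← mul_sub, covA_sub_covA hF himm, mul_neg,
    sum_neg_distrib, mul_sum, neg_eq_zero]
  rw [sum_comm]
  refine sum_eq_zero fun r _ => ?_
  simp only [mul_left_comm]
  rw [← mul_sum, sum_sff_mul_Fd hF himm, mul_zero]

/-- The tensor `A^β_{qa} g^{ab} F^α_b`. -/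
def sffJac (F : (Fin m → ℝ) → (Fin n → ℝ)) (β α : Fin n) (q : Fin m) (x : Fin m → ℝ) : ℝ :=
  gTrace F x fun a b => sff F β q a x * Fd F α b x

theorem sffJac_eq (β α : Fin n) (q : Fin m) (x : Fin m → ℝ) :
    sffJac F β α q x = (sffMat F β x * (gMat F x)⁻¹ * jac F x) q α := by
  rw [mul_gInv_mul_apply]
  rfl

theorem contDiff_sffJac (hF : ContDiff ℝ ∞ F) (himm : ∀ x, (gMat F x).det ≠ 0) (β α : Fin n)
    (q : Fin m) : ContDiff ℝ ∞ (sffJac F β α q) := by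
  unfold sffJac gTrace
  exact ContDiff.sum fun a _ => ContDiff.sum fun b _ => (smoothMat_gInv hF himm a b).mul
    ((contDiff_sff hF himm β q a).mul (contDiff_Fd hF α b))

theorem pd_sffJac (hF : ContDiff ℝ ∞ F) (himm : ∀ x, (gMat F x).det ≠ 0) (β α : Fin n)
    (p q : Fin m) (x : Fin m → ℝ) :
    pd (sffJac F β α q) p x = ∑ r, chr F r p q x * sffJac F β α r x
      + gTrace F x fun a b => covA F p β q a x * Fd F α b x + sff F β q a x * sff F α p b x := by
  have hS : SmoothMat (sffMat F β) := fun i j => contDiff_sff hF himm β i j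
  have h := congrFun (congrFun (pd_mul_gInv_mul hF himm hS (smoothMat_jac hF) p x) q) α
  rw [← covA_eq] at h
  simp only [Matrix.add_apply, mul_gInv_mul_apply, sffMat_eq] at h
  rw [gTrace_add, ← add_assoc]
  refine Eq.trans (congrArg (fun T => pd T p x) (funext fun y => sffJac_eq β α q y)) (h.trans ?_)
  rw [Matrix.mul_apply]
  simp only [← sffJac_eq]
  rfl

theorem covA_sub_covA_eq_sum (hF : ContDiff ℝ ∞ F) (himm : ∀ x, (gMat F x).det ≠ 0)
    (l q k : Fin m) (α : Fin n) (x : Fin m → ℝ) :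
    covA F l α q k x - covA F q α l k x
      = ∑ β, (sffJac F β α q x * sff F β l k x - sff F β q k x * sffJac F β α l x) := by
  rw [covA_sub_covA hF himm]
  simp only [riem_eq_sum himm, riemLow_eq_sffPair hF himm, sffJac, gTrace_mul, mul_gTrace,
    ← gTrace_sub]
  rw [← gTrace_sum, ← gTrace_swap, gTrace, ← sum_neg_distrib]
  refine sum_congr rfl fun r _ => ?_
  rw [sum_mul, ← sum_neg_distrib]
  refine sum_congr rfl fun a _ => ?_
  rw [sffPair, sffPair, ← sum_sub_distrib, mul_sum, sum_mul, mul_sum, ← sum_neg_distrib]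
  exact sum_congr rfl fun β _ => by ring

/-- The covariant derivative of the Codazzi equation. -/
theorem cov2A_sub_cov2A_swap (hF : ContDiff ℝ ∞ F) (himm : ∀ x, (gMat F x).det ≠ 0)
    (p l q k : Fin m) (α : Fin n) (x : Fin m → ℝ) :
    cov2A F p l α q k x - cov2A F p q α l k x
      = gTrace F x fun a b =>
        (sffCovPair F x l k p q a - sffCovPair F x q k p l a + sffCovPair F x q a p l k
          - sffCovPair F x l a p q k) * Fd F α b x
        + (sffPair F x q a l k - sffPair F x q k l a) * sff F α p b x := by
  let T (l q k : Fin m) (y : Fin m → ℝ) : ℝ := covA F l α q k y - covA F q α l k y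
  have hT (l q k : Fin m) : T l q k = fun y =>
      ∑ β, (sffJac F β α q y * sff F β l k y - sff F β q k y * sffJac F β α l y) :=
    funext (covA_sub_covA_eq_sum hF himm l q k α)
  have hJ (β : Fin n) (q : Fin m) := contDiff_sffJac hF himm β α q
  have hA (β : Fin n) (i j : Fin m) := contDiff_sff hF himm β i j
  have hcov : cov2A F p l α q k x - cov2A F p q α l k x
      = pd (T l q k) p x - ∑ r, chr F r p l x * T r q k x - ∑ r, chr F r p q x * T l r k x
        - ∑ r, chr F r p k x * T l q r x := by
    have := pd_sub (contDiff_covA hF himm l α q k) (contDiff_covA hF himm q α l k) p x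
    rw [this]
    simp only [cov2A, T, mul_sub, sum_sub_distrib]
    ring
  have hpd : pd (T l q k) p x = ∑ β, (pd (sffJac F β α q) p x * sff F β l k x
      + sffJac F β α q x * pd (sff F β l k) p x - (pd (sff F β q k) p x * sffJac F β α l x
      + sff F β q k x * pd (sffJac F β α l) p x)) := by
    rw [hT, pd_sum fun β => ((hJ β q).mul (hA β l k)).sub ((hA β q k).mul (hJ β l))]
    refine sum_congr rfl fun β _ => ?_
    rw [pd_sub ((hJ β q).mul (hA β l k)) ((hA β q k).mul (hJ β l)),
      pd_mul (hJ β q) (hA β l k), pd_mul (hA β q k) (hJ β l)]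
  rw [hcov, hpd]
  simp only [hT, mul_sum]
  rw [sum_comm (γ := Fin m), sum_comm (γ := Fin m), sum_comm (γ := Fin m), ← sum_sub_distrib,
    ← sum_sub_distrib, ← sum_sub_distrib]
  simp only [sffCovPair, sffPair, ← sum_add_distrib, ← sum_sub_distrib, sum_mul, gTrace_sum]
  refine sum_congr rfl fun β _ => ?_
  have hl : ∑ r, chr F r p l x
      * (sffJac F β α q x * sff F β r k x - sff F β q k x * sffJac F β α r x)
      = sffJac F β α q x * ∑ r, chr F r p l x * sff F β r k x
        - sff F β q k x * ∑ r, chr F r p l x * sffJac F β α r x := by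
    rw [mul_sum, mul_sum, ← sum_sub_distrib]
    exact sum_congr rfl fun r _ => by ring
  have hq : ∑ r, chr F r p q x
      * (sffJac F β α r x * sff F β l k x - sff F β r k x * sffJac F β α l x)
      = (∑ r, chr F r p q x * sffJac F β α r x) * sff F β l k x
        - (∑ r, chr F r p q x * sff F β r k x) * sffJac F β α l x := by
    rw [sum_mul, sum_mul, ← sum_sub_distrib]
    exact sum_congr rfl fun r _ => by ring
  have hk : ∑ r, chr F r p k x
      * (sffJac F β α q x * sff F β l r x - sff F β q r x * sffJac F β α l x)
      = sffJac F β α q x * ∑ r, chr F r p k x * sff F β l r x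
        - (∑ r, chr F r p k x * sff F β q r x) * sffJac F β α l x := by
    rw [mul_sum, sum_mul, ← sum_sub_distrib]
    exact sum_congr rfl fun r _ => by ring
  rw [hl, hq, hk]
  simp only [pd_sff, pd_sffJac hF himm]
  have key : (gTrace F x fun a b => covA F p β q a x * Fd F α b x + sff F β q a x * sff F α p b x)
        * sff F β l k x + sffJac F β α q x * covA F p β l k x
        - covA F p β q k x * sffJac F β α l x - sff F β q k x * (gTrace F x fun a b =>
          covA F p β l a x * Fd F α b x + sff F β l a x * sff F α p b x)
      = gTrace F x fun a b => (sff F β l k x * covA F p β q a x - sff F β q k x * covA F p β l a x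
        + sff F β q a x * covA F p β l k x - sff F β l a x * covA F p β q k x) * Fd F α b x
        + (sff F β q a x * sff F β l k x - sff F β q k x * sff F β l a x) * sff F α p b x := by
    simp only [sffJac, gTrace_mul, mul_gTrace, ← gTrace_add, ← gTrace_sub]
    congr 1
    funext a b
    ring
  rw [← key]
  ring

/-- The divergence of the Codazzi tensor, via the contracted second Bianchi identity. -/
theorem gTrace_codazzi_div (hF : ContDiff ℝ ∞ F) (himm : ∀ x, (gMat F x).det ≠ 0)
    (l k : Fin m) (α : Fin n) (x : Fin m → ℝ) :
    gTrace F x (fun p q => cov2A F p l α q k x - cov2A F p q α l k x)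
      = gTrace F x (fun p q => Fd F α p x * (covRic F q l k x - covRic F k q l x))
        + gTrace F x fun p q => gTrace F x fun a b =>
          sff F α p a x * (sffPair F x k l b q - sffPair F x k q b l) := by
  have hRic (q l k : Fin m) : covRic F q l k x = gTrace F x fun a b =>
      sffCovPair F x l k q a b + sffCovPair F x a b q l k
      - sffCovPair F x l b q a k - sffCovPair F x b k q l a := by
    rw [covRic_eq hF himm]
    simp only [gTrace_sub]
    rw [← gTrace_swap x fun a b => sffCovPair F x l b q a k]
  have hZ (p q : Fin m) : (gTrace F x fun a b =>
      sff F α p a x * (sffPair F x k l b q - sffPair F x k q b l)) = gTrace F x fun a b =>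
      sff F α p b x * (sffPair F x k l a q - sffPair F x k q a l) :=
    (gTrace_swap x _).symm
  rw [← gTrace_swap x fun p q => Fd F α p x * (covRic F q l k x - covRic F k q l x)]
  simp only [hRic, ← gTrace_sub, mul_gTrace]
  rw [gTrace_comm]
  simp only [hZ, cov2A_sub_cov2A_swap hF himm, ← gTrace_add]
  congr 1
  funext p q
  congr 1
  funext a b
  simp only [sffCovPair_swap_left hF x, sffCovPair_swap_right hF x, sffCovPair_codazzi hF himm x,
    sffPair_swap_left hF x, sffPair_swap_right hF x, sffPair_comm x]
  ring

/-- The divergence of the Codazzi tensor in its last slot. -/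
theorem gTrace_codazzi_trace (hF : ContDiff ℝ ∞ F) (himm : ∀ x, (gMat F x).det ≠ 0)
    (l k : Fin m) (α : Fin n) (x : Fin m → ℝ) :
    gTrace F x (fun p q => cov2A F l k α p q x - cov2A F l p α k q x)
      = -gTrace F x (fun p q => Fd F α p x * covRic F l q k x)
        - gTrace F x fun i p => ricci F p k x * sff F α i l x := by
  rw [← gTrace_swap x fun p q => Fd F α p x * covRic F l q k x,
    ← gTrace_swap x fun i p => ricci F p k x * sff F α i l x, ← gTrace_neg, ← gTrace_sub]
  simp only [covRic_eq hF himm, ricci_eq hF himm, gTrace_mul,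
    mul_gTrace, ← gTrace_sub, ← gTrace_neg]
  rw [gTrace_comm]
  simp only [cov2A_sub_cov2A_swap hF himm]
  congr 1
  funext p q
  congr 1
  funext a b
  rw [sff_symm hF α b l]
  simp only [sffCovPair_swap_left hF x, sffCovPair_swap_right hF x, sffPair_comm x]
  ring

theorem gTrace_riem_first (hF : ContDiff ℝ ∞ F) (himm : ∀ x, (gMat F x).det ≠ 0)
    (l k : Fin m) (α : Fin n) (x : Fin m → ℝ) :
    gTrace F x (fun p q => ∑ r, riem F r q p l x * sff F α r k x)
      = -gTrace F x fun i p => ricci F p l x * sff F α i k x := by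
  have h (p q : Fin m) : ∑ r, riem F r q p l x * sff F α r k x
      = gTrace F x fun r a => riemLow F a q p l x * sff F α r k x := by
    simp only [riem_eq_sum himm, gTrace, sum_mul, mul_assoc]
  simp only [h, riemLow_eq_sffPair hF himm, ricci_eq hF himm, gTrace_mul, ← gTrace_neg]
  rw [gTrace_comm]
  congr 1
  funext r a
  congr 1
  funext p q
  simp only [sffPair_swap_left hF x, sffPair_comm x]
  ring

theorem gTrace_riem_second (hF : ContDiff ℝ ∞ F) (himm : ∀ x, (gMat F x).det ≠ 0)
    (l k : Fin m) (α : Fin n) (x : Fin m → ℝ) :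
    gTrace F x (fun p q => ∑ r, riem F r k p l x * sff F α q r x)
      = gTrace F x fun p q => gTrace F x fun a b =>
          sff F α p a x * (sffPair F x k l b q - sffPair F x k q b l) := by
  have h (p q : Fin m) : ∑ r, riem F r k p l x * sff F α q r x
      = gTrace F x fun r a => riemLow F a k p l x * sff F α q r x := by
    simp only [riem_eq_sum himm, gTrace, sum_mul, mul_assoc]
  rw [← gTrace_swap]
  simp only [h, riemLow_eq_sffPair hF himm]
  congr 1
  funext p q
  congr 1
  funext a b
  simp only [sffPair_swap_left hF x, sffPair_swap_right hF x, sffPair_comm x]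
  ring

theorem sum_sff_mul_riemLow (hF : ContDiff ℝ ∞ F) (himm : ∀ x, (gMat F x).det ≠ 0)
    (l k : Fin m) (α : Fin n) (x : Fin m → ℝ) :
    ∑ j, ∑ i, sff F α j i x * (∑ a, ∑ b, gInv F j a x * gInv F i b x * riemLow F l a k b x)
      = gTrace F x fun p q => gTrace F x fun a b =>
          sff F α p a x * (sffPair F x k l b q - sffPair F x k q b l) := by
  simp only [gTrace, riemLow_eq_sffPair hF himm, mul_sum]
  refine sum_congr rfl fun j _ => ?_
  rw [sum_comm]
  exact sum_congr rfl fun a _ => sum_congr rfl fun i _ => sum_congr rfl fun b _ => by ring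

end Geometry

end Simons

/-- **Simons' identity.** `Δ A^α_{lk} = ∇_l∇_k H^α + R^m_l A^α_{mk} + R^m_k A^α_{ml}
- 2 A^α_{jm} R_l{}^j{}_k{}^m + F^α_m(∇_l R^m_k + ∇_k R^m_l - ∇^m R_{lk})`. -/
theorem simons_identity {m n : ℕ} (F : (Fin m → ℝ) → (Fin n → ℝ))
    (hF : ContDiff ℝ (⊤ : ℕ∞) F) (himm : ∀ x, (gMat F x).det ≠ 0) :
    ∀ (x : Fin m → ℝ) (α : Fin n) (l k : Fin m),
      ∑ p, ∑ q, gInv F p q x * cov2A F p q α l k x =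
        hessH F α l k x
          + ∑ i, (∑ p, gInv F i p x * ricci F p l x) * sff F α i k x
          + ∑ i, (∑ p, gInv F i p x * ricci F p k x) * sff F α i l x
          - 2 * ∑ j, ∑ i, sff F α j i x *
              (∑ a, ∑ b, gInv F j a x * gInv F i b x * riemLow F l a k b x)
          + ∑ p, Fd F α p x *
              (∑ q, gInv F p q x * (covRic F l q k x + covRic F k q l x - covRic F q l k x)) := by
  intro x α l k
  have hL (p q : Fin m) : cov2A F p q α l k x = cov2A F l k α p q x
      - ∑ r, riem F r q p l x * sff F α r k x - ∑ r, riem F r k p l x * sff F α q r x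
      - (cov2A F l k α p q x - cov2A F l p α k q x)
      - (cov2A F p l α q k x - cov2A F p q α l k x) := by
    have h := cov2A_sub_cov2A hF himm p l q k α x
    rw [cov2A_symm hF l p α q k] at h
    linarith
  have hlhs : gTrace F x (fun p q => cov2A F p q α l k x) = hessH F α l k x
      - gTrace F x (fun p q => ∑ r, riem F r q p l x * sff F α r k x)
      - gTrace F x (fun p q => ∑ r, riem F r k p l x * sff F α q r x)
      - gTrace F x (fun p q => cov2A F l k α p q x - cov2A F l p α k q x)
      - gTrace F x (fun p q => cov2A F p l α q k x - cov2A F p q α l k x) := by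
    rw [hessH_eq hF himm, ← gTrace_sub, ← gTrace_sub, ← gTrace_sub, ← gTrace_sub]
    exact congrArg _ (funext fun p => funext fun q => hL p q)
  have hric (u v : Fin m) : ∑ i, (∑ p, gInv F i p x * ricci F p u x) * sff F α i v x
      = gTrace F x fun i p => ricci F p u x * sff F α i v x := by
    simp only [gTrace, sum_mul, mul_assoc]
  have hcov : ∑ p, Fd F α p x *
        (∑ q, gInv F p q x * (covRic F l q k x + covRic F k q l x - covRic F q l k x))
      = gTrace F x (fun p q => Fd F α p x * covRic F l q k x)
        - gTrace F x (fun p q => Fd F α p x * (covRic F q l k x - covRic F k q l x)) := by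
    rw [← gTrace_sub]
    simp only [gTrace, mul_sum]
    exact sum_congr rfl fun p _ => sum_congr rfl fun q _ => by ring
  rw [hric, hric, hcov, sum_sff_mul_riemLow hF himm]
  refine hlhs.trans ?_
  rw [gTrace_riem_first hF himm, gTrace_riem_second hF himm, gTrace_codazzi_trace hF himm,
    gTrace_codazzi_div hF himm]
  ring

end
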